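/- arXiv:1701.07130 — 2 statements merged into one kernel-verified Lean document; each statement's English description precedes it below -/
import Mathlib

section
/- Let 𝔍 be the random monomial ideal of the ER-type model. (a) Let d and D be fixed with 1 ≤ d ≤ D and let p : ℕ → (0,1) (as a function of n). If n^d · p(n) → 0 as n → ∞, then P(β_{1,k}(S/𝔍) = 0 for all 1 ≤ k ≤ d) → 1; and if n^d · p(n) → ∞, then P(β_{1,k}(S/𝔍) = 0 for all 1 ≤ k ≤ d) → 0. (b) Let n be fixed, let d : ℕ → ℕ satisfy d(D) ≤ D and d(D) → ∞ as D → ∞, and let p : ℕ → (0,1) (as a function of D). If d(D)^n · p(D) → 0 as D → ∞, then the probability that 𝔍 has a minimal generator of degree strictly less than d(D) tends to 0; and if d(D)^n · p(D) → ∞, then this probability tends to 1. -/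
open Finset MvPolynomial Filter

noncomputable section

/-- The set of exponent vectors of nonconstant monomials in `n` variables of total degree
at most `D`. -/
def monSet (n D : ℕ) : Finset (Fin n → ℕ) :=
  (Fintype.piFinset fun _ : Fin n => Finset.range (D + 1)).filter
    fun α => 0 < ∑ i, α i ∧ ∑ i, α i ≤ D

/-- The monomial `x^α` of `MvPolynomial (Fin n) K` with exponent vector `α`. -/
def mono (K : Type*) [CommRing K] {n : ℕ} (α : Fin n → ℕ) : MvPolynomial (Fin n) K :=
  MvPolynomial.monomial (Finsupp.equivFunOnFinite.symm α) 1

/-- The monomial ideal generated by a set of exponent vectors. -/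
def idealOf (K : Type*) [CommRing K] {n : ℕ} (B : Finset (Fin n → ℕ)) :
    Ideal (MvPolynomial (Fin n) K) :=
  Ideal.span (mono K '' (B : Set (Fin n → ℕ)))

open Classical in
/-- The probability, under the ER-type model `ℐ(n,D,p)`, of the event `E` on random
generating sets `𝔅 ⊆ M(n,D)`. -/
def ERprob (n D : ℕ) (p : ℝ) (E : Set (Finset (Fin n → ℕ))) : ℝ :=
  ∑ B ∈ (monSet n D).powerset.filter (· ∈ E),
    p ^ B.card * (1 - p) ^ ((monSet n D).card - B.card)

/-- `I` is a monomial ideal. -/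
def IsMonomialIdeal (K : Type*) [CommRing K] {n : ℕ}
    (I : Ideal (MvPolynomial (Fin n) K)) : Prop :=
  ∃ G : Set (Fin n → ℕ), I = Ideal.span (mono K '' G)

/-- `x^α` is a minimal monomial generator of `I`: it lies in `I` and no proper divisor does. -/
def IsMinGen (K : Type*) [CommRing K] {n : ℕ} (I : Ideal (MvPolynomial (Fin n) K))
    (α : Fin n → ℕ) : Prop :=
  mono K α ∈ I ∧ ∀ β : Fin n → ℕ, (∀ i, β i ≤ α i) → β ≠ α → mono K β ∉ I

/-- `β₁(S/I)`: the number of minimal monomial generators of `I`. -/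
def beta1 (K : Type*) [CommRing K] {n : ℕ} (I : Ideal (MvPolynomial (Fin n) K)) : ℕ :=
  {α : Fin n → ℕ | IsMinGen K I α}.ncard

/-- `β_{1,d}(S/I)`: the number of minimal monomial generators of `I` of degree `d`. -/
def beta1d (K : Type*) [CommRing K] {n : ℕ} (I : Ideal (MvPolynomial (Fin n) K)) (d : ℕ) : ℕ :=
  {α : Fin n → ℕ | IsMinGen K I α ∧ ∑ i, α i = d}.ncard

/-- `h_I(d)`: the number of monomials of degree exactly `d` not contained in `I`. -/
def hilb (K : Type*) [CommRing K] {n : ℕ} (I : Ideal (MvPolynomial (Fin n) K)) (d : ℕ) : ℕ :=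
  {α : Fin n → ℕ | ∑ i, α i = d ∧ mono K α ∉ I}.ncard

/-- The nonconstant monomials of degree at most `D` whose degree is less than `m`. -/
def lowMonSet (n D m : ℕ) : Finset (Fin n → ℕ) :=
  (monSet n D).filter fun α => ∑ i, α i < m

theorem lowMonSet_subset (n D m : ℕ) : lowMonSet n D m ⊆ monSet n D :=
  Finset.filter_subset _ _

theorem mem_monSet {n D : ℕ} {α : Fin n → ℕ} :
    α ∈ monSet n D ↔ 0 < ∑ i, α i ∧ ∑ i, α i ≤ D := by
  simp only [monSet, mem_filter, Fintype.mem_piFinset, Finset.mem_range, and_iff_right_iff_imp]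
  rintro ⟨-, h⟩ i
  have := Finset.single_le_sum (f := α) (fun _ _ => Nat.zero_le _) (mem_univ i)
  omega

theorem mem_lowMonSet {n D m : ℕ} (hm : m ≤ D + 1) {α : Fin n → ℕ} :
    α ∈ lowMonSet n D m ↔ 0 < ∑ i, α i ∧ ∑ i, α i < m := by
  simp only [lowMonSet, mem_filter, mem_monSet]
  omega

theorem mono_mem_idealOf {K : Type*} [Field K] {n : ℕ} {B : Finset (Fin n → ℕ)}
    {α : Fin n → ℕ} : mono K α ∈ idealOf K B ↔ ∃ β ∈ B, β ≤ α := by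
  have h : mono K '' (B : Set (Fin n → ℕ)) =
      (fun s => monomial s (1 : K)) '' (Finsupp.equivFunOnFinite.symm '' (B : Set (Fin n → ℕ))) := by
    rw [Set.image_image]; rfl
  have hs : (mono K α).support = {Finsupp.equivFunOnFinite.symm α} := by
    classical simp [mono, support_monomial]
  rw [idealOf, h, mem_ideal_span_monomial_image, hs]
  simp only [Finset.mem_singleton, forall_eq, Set.exists_mem_image, Finset.mem_coe]
  rfl

theorem exists_isMinGen_le {K : Type*} [Field K] {n : ℕ} {B : Finset (Fin n → ℕ)}
    {β : Fin n → ℕ} (hβ : β ∈ B) : ∃ α ≤ β, IsMinGen K (idealOf K B) α := by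
  obtain ⟨α, hαβ, hα⟩ := exists_minimal_le_of_wellFoundedLT
    (fun γ => mono K γ ∈ idealOf K B) β (mono_mem_idealOf.2 ⟨β, hβ, le_rfl⟩)
  exact ⟨α, hαβ, hα.prop, fun γ hγ hne hmem => hne (le_antisymm hγ (hα.le_of_le hmem hγ))⟩

theorem IsMinGen.mem {K : Type*} [Field K] {n : ℕ} {B : Finset (Fin n → ℕ)}
    {α : Fin n → ℕ} (h : IsMinGen K (idealOf K B) α) : α ∈ B := by
  obtain ⟨β, hβ, hle⟩ := mono_mem_idealOf.1 h.1
  by_contra hα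
  exact h.2 β hle (fun e => hα (e ▸ hβ)) (mono_mem_idealOf.2 ⟨β, hβ, le_rfl⟩)

/-- A minimal generator of degree less than `m` exists iff the generating set contains a monomial
of degree less than `m`. -/
theorem exists_isMinGen_lt_iff {K : Type*} [Field K] {n D m : ℕ} {B : Finset (Fin n → ℕ)}
    (hB : B ⊆ monSet n D) :
    (∃ α : Fin n → ℕ, IsMinGen K (idealOf K B) α ∧ ∑ i, α i < m) ↔
      ¬ Disjoint B (lowMonSet n D m) := by
  rw [Finset.not_disjoint_iff]
  constructor
  · rintro ⟨α, hα, hlt⟩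
    exact ⟨α, hα.mem, mem_filter.2 ⟨hB hα.mem, hlt⟩⟩
  · rintro ⟨β, hβ, hlow⟩
    obtain ⟨α, hle, hα⟩ := exists_isMinGen_le (K := K) hβ
    exact ⟨α, hα, (Finset.sum_le_sum fun i _ => hle i).trans_lt (mem_filter.1 hlow).2⟩

theorem beta1d_eq_zero_iff {K : Type*} [Field K] {n k : ℕ} {B : Finset (Fin n → ℕ)} :
    beta1d K (idealOf K B) k = 0 ↔
      ∀ α : Fin n → ℕ, IsMinGen K (idealOf K B) α → ∑ i, α i ≠ k := by
  have hfin : {α : Fin n → ℕ | IsMinGen K (idealOf K B) α ∧ ∑ i, α i = k}.Finite :=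
    B.finite_toSet.subset fun α hα => hα.1.mem
  rw [beta1d, Set.ncard_eq_zero hfin, Set.eq_empty_iff_forall_notMem]
  simp

theorem forall_beta1d_eq_zero_iff {K : Type*} [Field K] {n D d : ℕ} {B : Finset (Fin n → ℕ)}
    (hB : B ⊆ monSet n D) :
    (∀ k ∈ Finset.Icc 1 d, beta1d K (idealOf K B) k = 0) ↔
      Disjoint B (lowMonSet n D (d + 1)) := by
  rw [← not_iff_not, ← exists_isMinGen_lt_iff (K := K) hB]
  simp only [beta1d_eq_zero_iff, Finset.mem_Icc]
  push Not
  constructor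
  · rintro ⟨k, ⟨-, hk⟩, α, hα, rfl⟩
    exact ⟨α, hα, by omega⟩
  · rintro ⟨α, hα, hlt⟩
    have := (mem_monSet.1 (hB hα.mem)).1
    exact ⟨_, ⟨this, by omega⟩, α, hα, rfl⟩

theorem ERprob_congr {n D : ℕ} {p : ℝ} {E F : Set (Finset (Fin n → ℕ))}
    (h : ∀ B ⊆ monSet n D, B ∈ E ↔ B ∈ F) : ERprob n D p E = ERprob n D p F := by
  classical
  unfold ERprob
  congr 1
  exact Finset.filter_congr fun B hB => h B (Finset.mem_powerset.1 hB)

theorem ERprob_disjoint {n D : ℕ} {p : ℝ} {A : Finset (Fin n → ℕ)} (hA : A ⊆ monSet n D) :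
    ERprob n D p {B | Disjoint B A} = (1 - p) ^ A.card := by
  classical
  have hpow : (monSet n D).powerset.filter (· ∈ {B | Disjoint B A}) =
      (monSet n D \ A).powerset := by
    ext B
    simp [Finset.subset_sdiff]
  have hsum := Finset.sum_pow_mul_eq_add_pow p (1 - p) (monSet n D \ A)
  rw [add_sub_cancel, one_pow] at hsum
  have hmul := congrArg ((1 - p) ^ A.card * ·) hsum
  simp only [mul_one, Finset.mul_sum] at hmul
  rw [← hmul, ERprob]
  refine Finset.sum_congr (by convert hpow) fun B hB => ?_
  have h₁ := Finset.card_le_card (Finset.mem_powerset.1 hB)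
  have h₂ := Finset.card_sdiff_add_card_eq_card hA
  rw [mul_left_comm, ← pow_add]
  congr 2
  omega

theorem ERprob_compl {n D : ℕ} {p : ℝ} (E : Set (Finset (Fin n → ℕ))) :
    ERprob n D p Eᶜ = 1 - ERprob n D p E := by
  classical
  have hsum := Finset.sum_pow_mul_eq_add_pow p (1 - p) (monSet n D)
  rw [add_sub_cancel, one_pow, ← Finset.sum_filter_add_sum_filter_not _ (· ∈ E)] at hsum
  rw [eq_sub_iff_add_eq', ← hsum]
  unfold ERprob
  congr!

theorem ERprob_beta1d {K : Type*} [Field K] {n D d : ℕ} {p : ℝ} :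
    ERprob n D p {B : Finset (Fin n → ℕ) |
      ∀ k ∈ Finset.Icc 1 d, beta1d K (idealOf K B) k = 0} =
      (1 - p) ^ (lowMonSet n D (d + 1)).card := by
  rw [← ERprob_disjoint (lowMonSet_subset n D (d + 1))]
  exact ERprob_congr fun B hB => forall_beta1d_eq_zero_iff hB

theorem ERprob_exists_isMinGen {K : Type*} [Field K] {n D m : ℕ} {p : ℝ} :
    ERprob n D p {B : Finset (Fin n → ℕ) |
      ∃ α : Fin n → ℕ, IsMinGen K (idealOf K B) α ∧ ∑ i, α i < m} =
      1 - (1 - p) ^ (lowMonSet n D m).card := by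
  rw [← ERprob_disjoint (lowMonSet_subset n D m), ← ERprob_compl]
  exact ERprob_congr fun B hB => exists_isMinGen_lt_iff hB

theorem tendsto_one_sub_pow_one {N : ℕ → ℕ} {p x : ℕ → ℝ} (c : ℝ)
    (hp : ∀ n, 0 < p n ∧ p n < 1) (hN : ∀ᶠ n in atTop, (N n : ℝ) ≤ c * x n)
    (hx : Tendsto (fun n => x n * p n) atTop (nhds 0)) :
    Tendsto (fun n => (1 - p n) ^ N n) atTop (nhds 1) := by
  have hlow : Tendsto (fun n => 1 - c * (x n * p n)) atTop (nhds 1) := by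
    simpa using (hx.const_mul c).const_sub 1
  refine tendsto_of_tendsto_of_tendsto_of_le_of_le' hlow tendsto_const_nhds ?_ ?_
  · filter_upwards [hN] with n hn
    have h₁ := one_add_mul_le_pow (a := -p n) (by linarith [hp n]) (N n)
    have h₂ := mul_le_mul_of_nonneg_right hn (hp n).1.le
    rw [← sub_eq_add_neg] at h₁
    linarith
  · exact Eventually.of_forall fun n =>
      pow_le_one₀ (by linarith [hp n]) (by linarith [hp n])

theorem tendsto_one_sub_pow_zero {N : ℕ → ℕ} {p x : ℕ → ℝ} {c : ℝ} (hc : 0 < c)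
    (hp : ∀ n, 0 < p n ∧ p n < 1) (hN : ∀ n, c * x n ≤ N n + 1)
    (hx : Tendsto (fun n => x n * p n) atTop atTop) :
    Tendsto (fun n => (1 - p n) ^ N n) atTop (nhds 0) := by
  have hNp : Tendsto (fun n => (N n : ℝ) * p n) atTop atTop := by
    refine tendsto_atTop_mono (fun n => ?_)
      (tendsto_atTop_add_const_right _ (-1) (hx.const_mul_atTop hc))
    have := mul_le_mul_of_nonneg_right (hN n) (hp n).1.le
    linarith [hp n]
  refine squeeze_zero (fun n => pow_nonneg (by linarith [hp n]) _) (fun n => ?_)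
    (Real.tendsto_exp_neg_atTop_nhds_zero.comp hNp)
  calc (1 - p n) ^ N n ≤ Real.exp (-p n) ^ N n :=
        pow_le_pow_left₀ (by linarith [hp n]) (Real.one_sub_le_exp_neg _) _
    _ = Real.exp (-(N n * p n)) := by rw [← Real.exp_nat_mul]; ring_nf

theorem card_piAntidiag_univ_fin (n k : ℕ) :
    (piAntidiag (univ : Finset (Fin n)) k).card = n.multichoose k := by
  rw [← Nat.subtype_card (p := fun P : Fin n → ℕ => ∑ i, P i = k) _ (by simp),
    ← Nat.card_congr (Sym.equivNatSumOfFintype (Fin n) k), Nat.card_eq_fintype_card,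
    Sym.card_sym_eq_multichoose, Fintype.card_fin]

theorem multichoose_le_pow : ∀ n k : ℕ, n.multichoose k ≤ n ^ k
  | _, 0 => by simp
  | 0, k + 1 => by simp
  | n + 1, k + 1 => by
    rw [Nat.multichoose_succ_succ]
    have h₁ := multichoose_le_pow n (k + 1)
    have h₂ := multichoose_le_pow (n + 1) k
    have h₃ : n ^ (k + 1) ≤ (n + 1) ^ k * n := by
      rw [pow_succ]
      gcongr
      omega
    rw [pow_succ (n + 1)]
    linarith

theorem pow_le_factorial_mul_multichoose (n k : ℕ) :
    n ^ k ≤ k.factorial * n.multichoose k := by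
  rw [Nat.multichoose_eq, ← Nat.ascFactorial_eq_factorial_mul_choose']
  exact Nat.pow_succ_le_ascFactorial n k

theorem card_lowMonSet_le_mul_pow {n D d : ℕ} (hn : 1 ≤ n) (hd : d ≤ D) :
    (lowMonSet n D (d + 1)).card ≤ d * n ^ d := by
  have hsub : lowMonSet n D (d + 1) ⊆
      (Finset.Icc 1 d).biUnion fun k => piAntidiag (univ : Finset (Fin n)) k := by
    intro α hα
    rw [mem_lowMonSet (by omega)] at hα
    simp only [mem_biUnion, Finset.mem_Icc, mem_piAntidiag, mem_univ, implies_true, and_true]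
    exact ⟨_, ⟨hα.1, by omega⟩, rfl⟩
  refine (Finset.card_le_card hsub).trans ((Finset.card_biUnion_le_card_mul _ _ (n ^ d) ?_).trans
    (by simp))
  intro k hk
  rw [card_piAntidiag_univ_fin]
  exact (multichoose_le_pow n k).trans (Nat.pow_le_pow_right hn (Finset.mem_Icc.1 hk).2)

theorem pow_le_factorial_mul_card_lowMonSet {n D d : ℕ} (hd₁ : 1 ≤ d) (hd : d ≤ D) :
    n ^ d ≤ d.factorial * (lowMonSet n D (d + 1)).card := by
  refine (pow_le_factorial_mul_multichoose n d).trans (Nat.mul_le_mul_left _ ?_)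
  rw [← card_piAntidiag_univ_fin]
  refine Finset.card_le_card fun α hα => ?_
  have hsum : ∑ i, α i = d := (mem_piAntidiag.1 hα).1
  rw [mem_lowMonSet (by omega)]
  omega

theorem card_lowMonSet_le_pow (n D m : ℕ) : (lowMonSet n D m).card ≤ m ^ n := by
  have hsub : lowMonSet n D m ⊆ Fintype.piFinset fun _ : Fin n => Finset.range m := by
    intro α hα
    have hlt := (mem_filter.1 hα).2
    exact Fintype.mem_piFinset.2 fun i => Finset.mem_range.2
      ((Finset.single_le_sum (f := α) (fun _ _ => Nat.zero_le _) (mem_univ i)).trans_lt hlt)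
  simpa using Finset.card_le_card hsub

theorem pow_le_pow_mul_card_lowMonSet_add_one {n D m : ℕ} (hn : 1 ≤ n) (hm : m ≤ D) :
    m ^ n ≤ n ^ n * ((lowMonSet n D m).card + 1) := by
  rcases Nat.eq_zero_or_pos m with rfl | hpos
  · simp [show n ≠ 0 by omega]
  have hsub : (Fintype.piFinset fun _ : Fin n => Finset.range ((m - 1) / n + 1)) ⊆
      insert 0 (lowMonSet n D m) := by
    intro α hα
    rw [Fintype.mem_piFinset] at hα
    have hle : ∑ i, α i ≤ n * ((m - 1) / n) := by
      simpa using Finset.sum_le_card_nsmul univ α ((m - 1) / n) fun i _ =>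
        Nat.lt_succ_iff.1 (Finset.mem_range.1 (hα i))
    have hdiv := Nat.mul_div_le (m - 1) n
    rw [Finset.mem_insert, mem_lowMonSet (by omega)]
    rcases Nat.eq_zero_or_pos (∑ i, α i) with h | h
    · left
      ext i
      simpa using Finset.sum_eq_zero_iff.1 h i (mem_univ i)
    · right
      omega
  have hcard := (Finset.card_le_card hsub).trans (Finset.card_insert_le _ _)
  simp only [Fintype.card_piFinset_const, Finset.card_range] at hcard
  have hlt := Nat.lt_mul_div_succ (m - 1) hn
  calc m ^ n ≤ (n * ((m - 1) / n + 1)) ^ n := Nat.pow_le_pow_left (by omega) n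
    _ = n ^ n * ((m - 1) / n + 1) ^ n := mul_pow _ _ _
    _ ≤ _ := Nat.mul_le_mul_left _ hcard

/-- Theorem 4.4. Thresholds for the first graded Betti numbers.
(a) For fixed `1 ≤ d ≤ D` and `p` a function of `n`: if `n^d p(n) → 0` then
`P(β_{1,k}(S/𝔍) = 0 for all 1 ≤ k ≤ d) → 1`, and if `n^d p(n) → ∞` then this
probability tends to `0`.
(b) For fixed `n`, `d = d(D) ≤ D` with `d(D) → ∞`, and `p` a function of `D`: if
`d(D)^n p(D) → 0` then the probability that `𝔍` has a minimal generator of degree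
strictly less than `d(D)` tends to `0`, and if `d(D)^n p(D) → ∞` then it tends to `1`. -/
theorem stmt14 (K : Type*) [Field K] :
    (∀ (d D : ℕ), 1 ≤ d → d ≤ D → ∀ p : ℕ → ℝ, (∀ n, 0 < p n ∧ p n < 1) →
      (Filter.Tendsto (fun n : ℕ => (n : ℝ) ^ d * p n) Filter.atTop (nhds 0) →
        Filter.Tendsto (fun n : ℕ => ERprob n D (p n)
            {B : Finset (Fin n → ℕ) | ∀ k ∈ Finset.Icc 1 d, beta1d K (idealOf K B) k = 0})
          Filter.atTop (nhds 1)) ∧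
      (Filter.Tendsto (fun n : ℕ => (n : ℝ) ^ d * p n) Filter.atTop Filter.atTop →
        Filter.Tendsto (fun n : ℕ => ERprob n D (p n)
            {B : Finset (Fin n → ℕ) | ∀ k ∈ Finset.Icc 1 d, beta1d K (idealOf K B) k = 0})
          Filter.atTop (nhds 0))) ∧
    (∀ (n : ℕ), 1 ≤ n → ∀ d : ℕ → ℕ, (∀ D, d D ≤ D) →
      Filter.Tendsto d Filter.atTop Filter.atTop →
      ∀ p : ℕ → ℝ, (∀ D, 0 < p D ∧ p D < 1) →
      (Filter.Tendsto (fun D : ℕ => (d D : ℝ) ^ n * p D) Filter.atTop (nhds 0) →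
        Filter.Tendsto (fun D : ℕ => ERprob n D (p D)
            {B : Finset (Fin n → ℕ) |
              ∃ α : Fin n → ℕ, IsMinGen K (idealOf K B) α ∧ ∑ i, α i < d D})
          Filter.atTop (nhds 0)) ∧
      (Filter.Tendsto (fun D : ℕ => (d D : ℝ) ^ n * p D) Filter.atTop Filter.atTop →
        Filter.Tendsto (fun D : ℕ => ERprob n D (p D)
            {B : Finset (Fin n → ℕ) |
              ∃ α : Fin n → ℕ, IsMinGen K (idealOf K B) α ∧ ∑ i, α i < d D})
          Filter.atTop (nhds 1))) := by
  refine ⟨fun d D hd₁ hd p hp => ⟨fun h => ?_, fun h => ?_⟩,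
    fun n hn d hd _ p hp => ⟨fun h => ?_, fun h => ?_⟩⟩
  · simp only [ERprob_beta1d]
    refine tendsto_one_sub_pow_one d hp ?_ h
    filter_upwards [eventually_ge_atTop 1] with n hn
    exact_mod_cast card_lowMonSet_le_mul_pow hn hd
  · simp only [ERprob_beta1d]
    have hpos : (0 : ℝ) < d.factorial := by exact_mod_cast d.factorial_pos
    refine tendsto_one_sub_pow_zero (inv_pos.2 hpos) hp (fun n => ?_) h
    have hcard : (n : ℝ) ^ d ≤ d.factorial * (lowMonSet n D (d + 1)).card := by
      exact_mod_cast pow_le_factorial_mul_card_lowMonSet hd₁ hd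
    linarith [(inv_mul_le_iff₀ hpos).2 hcard]
  · simp only [ERprob_exists_isMinGen]
    have hlim := tendsto_one_sub_pow_one (N := fun D => (lowMonSet n D (d D)).card) 1 hp
      (Eventually.of_forall fun D => by
        rw [one_mul]
        exact_mod_cast card_lowMonSet_le_pow n D (d D)) h
    simpa using hlim.const_sub 1
  · simp only [ERprob_exists_isMinGen]
    have hpos : (0 : ℝ) < (n : ℝ) ^ n := by positivity
    have hlim := tendsto_one_sub_pow_zero (N := fun D => (lowMonSet n D (d D)).card)
      (inv_pos.2 hpos) hp (fun D => by
        rw [inv_mul_le_iff₀ hpos]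
        exact_mod_cast pow_le_pow_mul_card_lowMonSet_add_one hn (hd D)) h
    simpa using hlim.const_sub 1

end
end

section
/- Let 𝔍 be the random monomial ideal of the ER-type model. (a) Let D be fixed and p : ℕ → (0,1) a function of n. If n^D · p(n) → 0 as n → ∞, then P(𝔍 = ⟨0⟩) → 1; and if n^D · p(n) → ∞, then P(𝔍 = ⟨0⟩) → 0. (b) Let n be fixed and p : ℕ → (0,1) a function of D. If D^n · p(D) → 0 as D → ∞, then P(𝔍 = ⟨0⟩) → 1; and if D^n · p(D) → ∞, then P(𝔍 = ⟨0⟩) → 0. -/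
open Finset MvPolynomial Filter

noncomputable section

theorem card_monSet_add_one (n D : ℕ) : (monSet n D).card + 1 = (n + D).choose D := by
  have h0 : (0 : Fin n → ℕ) ∉ monSet n D := by simp [monSet]
  have hmem (α : Fin n → ℕ) : α ∈ insert 0 (monSet n D) ↔ ∑ i, α i ≤ D := by
    simp only [monSet, mem_insert, mem_filter, Fintype.mem_piFinset, mem_range]
    constructor
    · rintro (rfl | h)
      · simp
      · exact h.2.2
    · intro h
      by_cases hα : α = 0
      · exact Or.inl hα
      · refine Or.inr ⟨fun i => ?_, ?_, h⟩
        · exact Nat.lt_succ_of_le ((single_le_sum (fun _ _ => Nat.zero_le _) (mem_univ i)).trans h)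
        · rw [pos_iff_ne_zero]
          intro h'
          exact hα (funext fun i => (Finset.sum_eq_zero_iff.1 h') i (mem_univ i))
  have hcard : (insert 0 (monSet n D)).card
      = ((univ : Finset (Fin (n + 1))).finsuppAntidiag D).card := by
    refine Finset.card_nbij'
      (fun α => Finsupp.equivFunOnFinite.symm (Fin.cons (D - ∑ i, α i) α))
      (fun f => Fin.tail f) ?_ ?_ ?_ ?_
    · intro α hα
      rw [mem_coe, hmem] at hα
      simp only [mem_coe, mem_finsuppAntidiag, subset_univ, and_true,
        Finsupp.coe_equivFunOnFinite_symm, Fin.sum_univ_succ, Fin.cons_zero, Fin.cons_succ]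
      omega
    · intro f hf
      simp only [mem_coe, mem_finsuppAntidiag, Fin.sum_univ_succ] at hf
      rw [mem_coe, hmem]
      simp only [Fin.tail]
      omega
    · intro α _
      simp
    · intro f hf
      simp only [mem_coe, mem_finsuppAntidiag, Fin.sum_univ_succ] at hf
      ext i
      refine Fin.cases ?_ (fun j => ?_) i
      · simp only [Finsupp.coe_equivFunOnFinite_symm, Fin.cons_zero, Fin.tail]
        omega
      · simp [Fin.tail]
  rw [← card_insert_of_notMem h0, hcard, card_finsuppAntidiag_nat_eq_choose, card_univ,
    Fintype.card_fin, Nat.add_right_comm, Nat.add_sub_cancel]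

theorem idealOf_eq_bot_iff (K : Type*) [Field K] {n : ℕ} (B : Finset (Fin n → ℕ)) :
    idealOf K B = ⊥ ↔ B = ∅ := by
  constructor
  · intro h
    rw [eq_empty_iff_forall_notMem]
    intro α hα
    have := Ideal.span_eq_bot.1 h (mono K α) (Set.mem_image_of_mem _ hα)
    simp [mono, MvPolynomial.monomial_eq_zero] at this
  · rintro rfl
    simp [idealOf]

theorem ERprob_idealOf_eq_bot (K : Type*) [Field K] (n D : ℕ) (p : ℝ) :
    ERprob n D p {B : Finset (Fin n → ℕ) | idealOf K B = ⊥} = (1 - p) ^ (monSet n D).card := by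
  classical
  have : (monSet n D).powerset.filter
      (· ∈ {B : Finset (Fin n → ℕ) | idealOf K B = ⊥}) = {∅} := by
    ext B
    simp only [mem_filter, mem_powerset, Set.mem_ofPred_eq, idealOf_eq_bot_iff, mem_singleton]
    exact ⟨And.right, fun h => ⟨h ▸ empty_subset _, h⟩⟩
  rw [ERprob, Finset.sum_congr (s₂ := {∅}) (by convert this) fun _ _ => rfl]
  simp

/-- If `p x` is a probability and `N x + 1 = (x + m).choose m` trials are made, then the
probability `(1 - p x) ^ N x` of no success has threshold `p x = x ^ (-m)`. -/
theorem tendsto_one_sub_pow_of_add_one_eq_choose {m : ℕ} {N : ℕ → ℕ} {p : ℕ → ℝ}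
    (hN : ∀ x, N x + 1 = (x + m).choose m) (hp : ∀ x, 0 < p x ∧ p x < 1) :
    (Tendsto (fun x : ℕ => (x : ℝ) ^ m * p x) atTop (nhds 0) →
      Tendsto (fun x => (1 - p x) ^ N x) atTop (nhds 1)) ∧
    (Tendsto (fun x : ℕ => (x : ℝ) ^ m * p x) atTop atTop →
      Tendsto (fun x => (1 - p x) ^ N x) atTop (nhds 0)) := by
  constructor
  · intro h
    have hlim : Tendsto (fun x : ℕ => 1 - (2 : ℝ) ^ m * ((x : ℝ) ^ m * p x)) atTop (nhds 1) := by
      simpa using (h.const_mul ((2 : ℝ) ^ m)).const_sub 1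
    refine tendsto_of_tendsto_of_tendsto_of_le_of_le' hlim tendsto_const_nhds ?_ ?_
    · filter_upwards [eventually_ge_atTop 1] with x hx
      have hle : (N x : ℝ) ≤ (2 : ℝ) ^ m * (x : ℝ) ^ m := by
        have : N x ≤ 2 ^ m * x ^ m :=
          calc N x ≤ (x + m).choose m := by rw [← hN]; exact Nat.le_succ _
            _ ≤ (x + 1) ^ m := Nat.choose_add_le_add_one_pow x m
            _ ≤ (2 * x) ^ m := Nat.pow_le_pow_left (by omega) m
            _ = 2 ^ m * x ^ m := mul_pow _ _ _
        exact_mod_cast this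
      calc 1 - (2 : ℝ) ^ m * ((x : ℝ) ^ m * p x) ≤ 1 + (N x : ℝ) * -p x := by
            nlinarith [mul_le_mul_of_nonneg_right hle (hp x).1.le]
        _ ≤ (1 + -p x) ^ N x := one_add_mul_le_pow (by linarith [(hp x).2]) _
        _ = (1 - p x) ^ N x := by rw [← sub_eq_add_neg]
    · exact Eventually.of_forall fun x =>
        pow_le_one₀ (by linarith [(hp x).2]) (by linarith [(hp x).1])
  · intro h
    have hm : (0 : ℝ) < (m.factorial : ℝ) := by exact_mod_cast m.factorial_pos
    have hlim : Tendsto (fun x : ℕ => (x : ℝ) ^ m * p x / m.factorial - 1) atTop atTop :=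
      tendsto_atTop_add_const_right _ _ (h.atTop_div_const hm)
    have hexp := Real.tendsto_exp_neg_atTop_nhds_zero.comp hlim
    refine squeeze_zero (fun x => pow_nonneg (by linarith [(hp x).2]) _) (fun x => ?_) hexp
    have hle : (x : ℝ) ^ m / m.factorial ≤ N x + 1 := by
      rw [div_le_iff₀' hm]
      have : x ^ m ≤ m.factorial * (N x + 1) := by
        rw [hN, ← Nat.ascFactorial_eq_factorial_mul_choose]
        exact (Nat.pow_le_pow_left (Nat.le_succ x) m).trans (Nat.pow_succ_le_ascFactorial _ _)
      exact_mod_cast this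
    calc (1 - p x) ^ N x ≤ Real.exp (-p x) ^ N x :=
          pow_le_pow_left₀ (by linarith [(hp x).2]) (Real.one_sub_le_exp_neg _) _
      _ = Real.exp (-(N x * p x)) := by rw [← Real.exp_nat_mul, mul_neg]
      _ ≤ Real.exp (-((x : ℝ) ^ m * p x / m.factorial - 1)) := by
          rw [Real.exp_le_exp]
          have := mul_le_mul_of_nonneg_right hle (hp x).1.le
          rw [div_mul_eq_mul_div] at this
          linarith [(hp x).2]

/-- Corollary 4.5. Thresholds for `𝔍 = ⟨0⟩`.
(a) For fixed `D` and `p` a function of `n`: if `n^D p(n) → 0` then `P(𝔍 = ⟨0⟩) → 1`,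
and if `n^D p(n) → ∞` then `P(𝔍 = ⟨0⟩) → 0`.
(b) For fixed `n` and `p` a function of `D`: if `D^n p(D) → 0` then `P(𝔍 = ⟨0⟩) → 1`,
and if `D^n p(D) → ∞` then `P(𝔍 = ⟨0⟩) → 0`. -/
theorem stmt16 (K : Type*) [Field K] :
    (∀ D : ℕ, 1 ≤ D → ∀ p : ℕ → ℝ, (∀ n, 0 < p n ∧ p n < 1) →
      (Filter.Tendsto (fun n : ℕ => (n : ℝ) ^ D * p n) Filter.atTop (nhds 0) →
        Filter.Tendsto (fun n : ℕ => ERprob n D (p n)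
            {B : Finset (Fin n → ℕ) | idealOf K B = ⊥}) Filter.atTop (nhds 1)) ∧
      (Filter.Tendsto (fun n : ℕ => (n : ℝ) ^ D * p n) Filter.atTop Filter.atTop →
        Filter.Tendsto (fun n : ℕ => ERprob n D (p n)
            {B : Finset (Fin n → ℕ) | idealOf K B = ⊥}) Filter.atTop (nhds 0))) ∧
    (∀ n : ℕ, 1 ≤ n → ∀ p : ℕ → ℝ, (∀ D, 0 < p D ∧ p D < 1) →
      (Filter.Tendsto (fun D : ℕ => (D : ℝ) ^ n * p D) Filter.atTop (nhds 0) →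
        Filter.Tendsto (fun D : ℕ => ERprob n D (p D)
            {B : Finset (Fin n → ℕ) | idealOf K B = ⊥}) Filter.atTop (nhds 1)) ∧
      (Filter.Tendsto (fun D : ℕ => (D : ℝ) ^ n * p D) Filter.atTop Filter.atTop →
        Filter.Tendsto (fun D : ℕ => ERprob n D (p D)
            {B : Finset (Fin n → ℕ) | idealOf K B = ⊥}) Filter.atTop (nhds 0))) := by
  simp only [ERprob_idealOf_eq_bot]
  exact ⟨fun D _ p hp => tendsto_one_sub_pow_of_add_one_eq_choose
      (fun n => card_monSet_add_one n D) hp,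
    fun n _ p hp => tendsto_one_sub_pow_of_add_one_eq_choose
      (fun D => by rw [card_monSet_add_one, Nat.add_comm D n, Nat.choose_symm_add]) hp⟩

end
end
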